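/- Let A be an N×s complex matrix and B an N×t complex matrix with A*A = I_s and B*B = I_t, and put U = (2·B·B* − I_N)·(2·A·A* − I_N). Then (X + 1)^|s−t| divides the characteristic polynomial det(X·I_N − U) in ℂ[X]; in particular, when s ≠ t, −1 is an eigenvalue of U of algebraic multiplicity at least |s−t|. -/

import Mathlib

open Matrix Polynomial

lemma aux_mult {N s t : ℕ} (M : Matrix (Fin N) (Fin N) ℂ) (A : Matrix (Fin N) (Fin s) ℂ)
    (C : Matrix (Fin t) (Fin s) ℂ) (hA : Aᴴ * A = 1)
    (h : ∀ v, C *ᵥ v = 0 → M *ᵥ (A *ᵥ v) = - (A *ᵥ v)) :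
    s - t ≤ M.charpoly.rootMultiplicity (-1) := by
  have hinj : Function.Injective (Matrix.toLin' A) := by
    intro v w hvw
    have := congrArg (fun x => Aᴴ *ᵥ x) hvw
    simpa [Matrix.toLin'_apply, Matrix.mulVec_mulVec, hA] using this
  have h1 := LinearMap.finrank_range_add_finrank_ker (Matrix.toLin' C)
  have h2 : Module.finrank ℂ (LinearMap.range (Matrix.toLin' C)) ≤ t := by
    simpa using Submodule.finrank_le (LinearMap.range (Matrix.toLin' C))
  have h3 : Module.finrank ℂ ((LinearMap.ker (Matrix.toLin' C)).map (Matrix.toLin' A)) =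
      Module.finrank ℂ (LinearMap.ker (Matrix.toLin' C)) :=
    (LinearEquiv.finrank_eq (Submodule.equivMapOfInjective _ hinj _)).symm
  have h4 : (LinearMap.ker (Matrix.toLin' C)).map (Matrix.toLin' A) ≤
      Module.End.maxGenEigenspace (Matrix.toLin' M) (-1) := by
    rintro _ ⟨v, hv, rfl⟩
    refine Module.End.genEigenspace_le_maximal (Matrix.toLin' M) (-1) 1 ?_
    have hv' : C *ᵥ v = 0 := by simpa using hv
    have : Matrix.toLin' A v ∈ Module.End.eigenspace (Matrix.toLin' M) (-1) := by
      rw [Module.End.mem_eigenspace_iff]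
      simpa using h v hv'
    exact this
  have h5 := Submodule.finrank_mono h4
  rw [LinearMap.finrank_maxGenEigenspace_eq, Matrix.charpoly_toLin'] at h5
  rw [Module.finrank_fin_fun] at h1
  omega

lemma aux_natAbs {N s t : ℕ} (A : Matrix (Fin N) (Fin s) ℂ) (B : Matrix (Fin N) (Fin t) ℂ)
    (hA : Aᴴ * A = 1) (hB : Bᴴ * B = 1) :
    ((s : ℤ) - (t : ℤ)).natAbs ≤
      ((((2 : ℂ) • (B * Bᴴ) - 1) * ((2 : ℂ) • (A * Aᴴ) - 1)).charpoly).rootMultiplicity (-1) := by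
  have h1 := aux_mult (((2 : ℂ) • (B * Bᴴ) - 1) * ((2 : ℂ) • (A * Aᴴ) - 1)) A (Bᴴ * A) hA (by
    intro v hv
    have e : ((2 : ℂ) • (A * Aᴴ) - 1) * A = A := by
      rw [Matrix.sub_mul, Matrix.smul_mul, Matrix.mul_assoc, hA, two_smul]; simp
    have e2 : ((2 : ℂ) • (B * Bᴴ) - 1) * A = (2 : ℂ) • (B * (Bᴴ * A)) - A := by
      rw [Matrix.sub_mul, Matrix.smul_mul, Matrix.mul_assoc]; simp
    rw [Matrix.mulVec_mulVec, Matrix.mul_assoc, e, e2, Matrix.sub_mulVec, Matrix.smul_mulVec,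
      ← Matrix.mulVec_mulVec, hv]
    simp)
  have h2 := aux_mult (((2 : ℂ) • (B * Bᴴ) - 1) * ((2 : ℂ) • (A * Aᴴ) - 1)) B (Aᴴ * B) hB (by
    intro v hv
    have e : ((2 : ℂ) • (B * Bᴴ) - 1) * B = B := by
      rw [Matrix.sub_mul, Matrix.smul_mul, Matrix.mul_assoc, hB, two_smul]; simp
    have e2 : ((2 : ℂ) • (A * Aᴴ) - 1) * B = (2 : ℂ) • (A * (Aᴴ * B)) - B := by
      rw [Matrix.sub_mul, Matrix.smul_mul, Matrix.mul_assoc]; simp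
    rw [Matrix.mulVec_mulVec, Matrix.mul_assoc, e2, Matrix.mul_sub, e, Matrix.mul_smul,
      ← Matrix.mul_assoc, Matrix.sub_mulVec, Matrix.smul_mulVec,
      ← Matrix.mulVec_mulVec, hv]
    simp)
  omega



/-- `(X + 1)^|s - t|` divides the characteristic polynomial of
`U = (2 B Bᴴ - I)(2 A Aᴴ - I)`; in particular, when `s ≠ t`, the eigenvalue `-1` of `U`
has algebraic multiplicity at least `|s - t|`. -/
theorem neg_one_is_eigenvalue_of_multiplicity
    (N s t : ℕ) (A : Matrix (Fin N) (Fin s) ℂ) (B : Matrix (Fin N) (Fin t) ℂ)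
    (hA : Aᴴ * A = 1) (hB : Bᴴ * B = 1) :
    ((X + 1) ^ ((s : ℤ) - (t : ℤ)).natAbs ∣
        (((2 : ℂ) • (B * Bᴴ) - 1) * ((2 : ℂ) • (A * Aᴴ) - 1)).charpoly) ∧
      (s ≠ t →
        ((s : ℤ) - (t : ℤ)).natAbs ≤
          ((((2 : ℂ) • (B * Bᴴ) - 1) * ((2 : ℂ) • (A * Aᴴ) - 1)).charpoly).rootMultiplicity (-1)) := by

  have h := aux_natAbs A B hA hB
  refine ⟨?_, fun _ => h⟩
  have h0 := (Polynomial.le_rootMultiplicity_iff (Matrix.charpoly_monic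
    (((2 : ℂ) • (B * Bᴴ) - 1) * ((2 : ℂ) • (A * Aᴴ) - 1))).ne_zero).1 h
  simpa using h0
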